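/- Fix K ≥ 1, a nonempty subset S ⊆ {1,…,K}, an index k ∈ S, constants p_1,…,p_K > 0 and p_tr > 0, and a symmetric positive definite matrix R ∈ ℝ^{S×S}. For each M ∈ ℕ, let C_1(M),…,C_K(M) ∈ ℂ^{M×M} be Hermitian positive semidefinite with real diagonals ĉ_n(M) ∈ ℝ^M, let Ξ̂_M ∈ ℝ^{M×|S|} have columns ĉ_n(M) for n ∈ S, let D_M ∈ ℝ^{M×M} be diagonal with positive diagonal entries, and define â_k(M) = D_M·Ξ̂_M·(R + Ξ̂_MᵀD_MΞ̂_M)⁻¹·e_k ∈ ℝ^M, Z_M = I + Σ_{n=1}^K p_n C_n(M), Q_M = (1/p_tr)·I + Σ_{n∈S} C_n(M), and the SINR γ_k(M) = p_k·|ĉ_k(M)ᵀ â_k(M)|² / ( â_k(M)ᴴ(Q_Mᵀ ∘ Z_M)â_k(M) + Σ_{n∈S, n≠k} p_n·|ĉ_n(M)ᵀ â_k(M)|² ). Assume: (i) liminf_{M→∞} min_{λ∈ℂ^{|S|}, ‖λ‖₂=1} (1/M)·‖Σ_{n∈S} λ_n·diag(ĉ_n(M))‖_F² > 0; (ii) limsup_{M→∞}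 ‖C_n(M)‖₂ < ∞ for all n ∈ {1,…,K}; (iii) limsup_{M→∞} ‖D_M‖₂ < ∞ and limsup_{M→∞} ‖D_M⁻¹‖₂ < ∞. Then liminf_{M→∞} γ_k(M)/M > 0. -/

import Mathlib

open Matrix Filter
open scoped ComplexOrder

/-- The spectral norm (largest singular value) of a real or complex matrix. -/
noncomputable def specNorm {𝕜 : Type*} [RCLike 𝕜] {m n : Type*} [Fintype m] [Fintype n]
    [DecidableEq n] (A : Matrix m n 𝕜) : ℝ :=
  ‖LinearMap.toContinuousLinearMap (Matrix.toEuclideanLin A)‖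

/-- The Frobenius norm of a complex matrix. -/
noncomputable def frobNorm {m n : Type*} [Fintype m] [Fintype n] (A : Matrix m n ℂ) : ℝ :=
  Real.sqrt (∑ i, ∑ j, ‖A i j‖ ^ 2)

lemma norm_apply_le_specNorm {𝕜 : Type*} [RCLike 𝕜] {m n : Type*} [Fintype m] [Fintype n]
    [DecidableEq n] (A : Matrix m n 𝕜) (i : m) (j : n) : ‖A i j‖ ≤ specNorm A := by
  have h := (LinearMap.toContinuousLinearMap (Matrix.toEuclideanLin A)).le_opNorm
    (EuclideanSpace.single j (1 : 𝕜))
  have h' := PiLp.norm_apply_le (p := 2)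
    (Matrix.toEuclideanLin A (EuclideanSpace.single j (1 : 𝕜))) i
  simp only [LinearMap.coe_toContinuousLinearMap', PiLp.norm_single, norm_one,
    mul_one] at h
  refine le_trans (le_of_eq ?_) (h'.trans h)
  simp [Matrix.toLpLin_apply]

lemma re_dotProduct_mulVec_le_specNorm {n : Type*} [Fintype n] [DecidableEq n]
    (A : Matrix n n ℂ) (x : n → ℂ) :
    (star x ⬝ᵥ A *ᵥ x).re ≤ specNorm A * ∑ i, ‖x i‖ ^ 2 := by
  set y : EuclideanSpace ℂ n := WithLp.toLp 2 x
  have h := (LinearMap.toContinuousLinearMap (Matrix.toEuclideanLin A)).le_opNorm y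
  have hin : inner ℂ y (Matrix.toEuclideanLin A y) = star x ⬝ᵥ A *ᵥ x := by
    simp [y, Matrix.toLpLin_apply, PiLp.inner_apply, dotProduct, mul_comm]
  have hn : ‖y‖ ^ 2 = ∑ i, ‖x i‖ ^ 2 := EuclideanSpace.norm_sq_eq y
  calc (star x ⬝ᵥ A *ᵥ x).re ≤ ‖inner ℂ y (Matrix.toEuclideanLin A y)‖ := by
        rw [← hin]; exact Complex.re_le_norm _
    _ ≤ ‖y‖ * ‖Matrix.toEuclideanLin A y‖ := norm_inner_le_norm _ _
    _ ≤ ‖y‖ * (specNorm A * ‖y‖) := by gcongr; exact h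
    _ = specNorm A * ∑ i, ‖x i‖ ^ 2 := by rw [← hn]; ring

lemma Matrix.IsHermitian.posSemidef_smul_one_sub {n : Type*} [Fintype n] [DecidableEq n]
    {A : Matrix n n ℂ} (hA : A.IsHermitian) {c : ℝ} (hc : specNorm A ≤ c) :
    ((c : ℂ) • 1 - A).PosSemidef := by
  have hH : ((c : ℂ) • (1 : Matrix n n ℂ) - A).IsHermitian := by
    refine Matrix.IsHermitian.sub ?_ hA
    rw [Matrix.IsHermitian, Matrix.conjTranspose_smul, Matrix.conjTranspose_one]
    simp
  refine .of_dotProduct_mulVec_nonneg hH fun x => ?_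
  have him := hH.im_star_dotProduct_mulVec_self x
  rw [Complex.nonneg_iff]
  refine ⟨?_, him.symm⟩
  have h1 := re_dotProduct_mulVec_le_specNorm A x
  have h2 : (star x ⬝ᵥ x).re = ∑ i, ‖x i‖ ^ 2 := by
    simp [dotProduct, ← Complex.normSq_eq_norm_sq, Complex.normSq_apply]
  have h3 : (star x ⬝ᵥ ((c : ℂ) • 1 - A) *ᵥ x).re =
      c * ∑ i, ‖x i‖ ^ 2 - (star x ⬝ᵥ A *ᵥ x).re := by
    rw [Matrix.sub_mulVec, dotProduct_sub, Matrix.smul_mulVec, Matrix.one_mulVec,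
      dotProduct_smul, smul_eq_mul, Complex.sub_re, Complex.re_ofReal_mul, h2]
  rw [h3]
  have : specNorm A * ∑ i, ‖x i‖ ^ 2 ≤ c * ∑ i, ‖x i‖ ^ 2 := by gcongr
  linarith

/-- The quadratic form of `(c • 1)ᵀ ⊙ Z` at a real vector only sees the diagonal of `Z`. -/
lemma re_dotProduct_smul_one_hadamard {n : Type*} [Fintype n] [DecidableEq n]
    (Z : Matrix n n ℂ) (c : ℝ) (a : n → ℝ) :
    (star (fun i => (a i : ℂ)) ⬝ᵥ (((c : ℂ) • (1 : Matrix n n ℂ))ᵀ ⊙ Z) *ᵥ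
      (fun i => (a i : ℂ))).re = c * ∑ i, (Z i i).re * a i ^ 2 := by
  have h : (((c : ℂ) • (1 : Matrix n n ℂ))ᵀ ⊙ Z) = Matrix.diagonal fun i => c * Z i i := by
    ext i j
    by_cases hij : i = j <;> simp [Matrix.hadamard, Matrix.one_apply, hij]
    grind
  rw [h]
  simp only [dotProduct, Matrix.mulVec_diagonal, Pi.star_apply, Complex.star_def,
    Complex.conj_ofReal, Complex.re_sum, Finset.mul_sum]
  refine Finset.sum_congr rfl fun i _ => ?_
  simp
  ring

lemma sub_hadamard {m n : Type*} (A B Z : Matrix m n ℂ) : (A - B) ⊙ Z = A ⊙ Z - B ⊙ Z := by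
  ext i j
  simp [sub_mul]

lemma le_re_dotProduct_hadamard {n : Type*} [Fintype n] [DecidableEq n]
    {Q Z : Matrix n n ℂ} {c : ℝ} (hQ : (Q - (c : ℂ) • 1).PosSemidef) (hZ : Z.PosSemidef)
    (a : n → ℝ) :
    c * ∑ i, (Z i i).re * a i ^ 2 ≤
      (star (fun i => (a i : ℂ)) ⬝ᵥ (Qᵀ ⊙ Z) *ᵥ (fun i => (a i : ℂ))).re := by
  have h := (hQ.transpose.hadamard hZ).re_dotProduct_nonneg (fun i => (a i : ℂ))
  rw [Matrix.transpose_sub, sub_hadamard, Matrix.sub_mulVec, dotProduct_sub, map_sub,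
    sub_nonneg] at h
  exact (re_dotProduct_smul_one_hadamard Z c a).symm.trans_le h

lemma re_dotProduct_hadamard_le {n : Type*} [Fintype n] [DecidableEq n]
    {Q Z : Matrix n n ℂ} {c : ℝ} (hQ : ((c : ℂ) • 1 - Q).PosSemidef) (hZ : Z.PosSemidef)
    (a : n → ℝ) :
    (star (fun i => (a i : ℂ)) ⬝ᵥ (Qᵀ ⊙ Z) *ᵥ (fun i => (a i : ℂ))).re ≤
      c * ∑ i, (Z i i).re * a i ^ 2 := by
  have h := (hQ.transpose.hadamard hZ).re_dotProduct_nonneg (fun i => (a i : ℂ))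
  rw [Matrix.transpose_sub, sub_hadamard, Matrix.sub_mulVec, dotProduct_sub, map_sub,
    sub_nonneg] at h
  exact h.trans_eq (re_dotProduct_smul_one_hadamard Z c a)

lemma dotProduct_gram_mulVec {m ι : Type*} [Fintype m] [Fintype ι] [DecidableEq m]
    (X : Matrix m ι ℝ) (d : m → ℝ) (v : ι → ℝ) :
    v ⬝ᵥ (Xᵀ * Matrix.diagonal d * X) *ᵥ v = ∑ i, d i * (X *ᵥ v) i ^ 2 := by
  rw [← Matrix.mulVec_mulVec, ← Matrix.mulVec_mulVec, Matrix.dotProduct_mulVec,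
    Matrix.vecMul_transpose, dotProduct]
  refine Finset.sum_congr rfl fun i _ => ?_
  rw [Matrix.mulVec_diagonal]
  ring

lemma regularized_gram_posDef {m ι : Type*} [Fintype m] [Fintype ι] [DecidableEq m]
    {R : Matrix ι ι ℝ} (hR : R.PosDef) (X : Matrix m ι ℝ) {d : m → ℝ} (hd : ∀ i, 0 < d i) :
    (R + Xᵀ * Matrix.diagonal d * X).PosDef := by
  refine hR.add_posSemidef ?_
  have h := (Matrix.PosSemidef.diagonal (d := d) fun i => (hd i).le).conjTranspose_mul_mul_same X
  rwa [Matrix.conjTranspose_eq_transpose_of_trivial] at h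

lemma regularized_gram_mulVec_inv {m ι : Type*} [Fintype m] [Fintype ι] [DecidableEq m]
    [DecidableEq ι] {R : Matrix ι ι ℝ} (hR : R.PosDef) (X : Matrix m ι ℝ) {d : m → ℝ}
    (hd : ∀ i, 0 < d i) (w : ι → ℝ) :
    (Xᵀ * Matrix.diagonal d * X) *ᵥ ((R + Xᵀ * Matrix.diagonal d * X)⁻¹ *ᵥ w) =
      w - R *ᵥ ((R + Xᵀ * Matrix.diagonal d * X)⁻¹ *ᵥ w) := by
  have hu := (regularized_gram_posDef hR X hd).isUnit
  rw [eq_sub_iff_add_eq', ← Matrix.add_mulVec, Matrix.mulVec_mulVec,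
    Matrix.mul_nonsing_inv _ ((Matrix.isUnit_iff_isUnit_det _).1 hu), Matrix.one_mulVec]

/-- If the weighted Gram matrix is at least `c`, the columns of the regularized inverse have
entries of size at most `c⁻¹`. -/
lemma abs_regularized_gram_inv_apply_le {m ι : Type*} [Fintype m] [Fintype ι] [DecidableEq m]
    [DecidableEq ι] {R : Matrix ι ι ℝ} (hR : R.PosDef) (X : Matrix m ι ℝ) {d : m → ℝ}
    (hd : ∀ i, 0 < d i) {c : ℝ} (hc : 0 < c)
    (hX : ∀ v : ι → ℝ, c * ∑ i, v i ^ 2 ≤ ∑ i, d i * (X *ᵥ v) i ^ 2) (k i : ι) :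
    |((R + Xᵀ * Matrix.diagonal d * X)⁻¹ *ᵥ Pi.single k 1) i| ≤ c⁻¹ := by
  set b := (R + Xᵀ * Matrix.diagonal d * X)⁻¹ *ᵥ Pi.single k (1 : ℝ) with hb
  have h1 := regularized_gram_mulVec_inv hR X hd (Pi.single k 1)
  rw [← hb] at h1
  have h2 := dotProduct_gram_mulVec X d b
  rw [h1, dotProduct_sub, dotProduct_single, mul_one] at h2
  have h3 : 0 ≤ b ⬝ᵥ R *ᵥ b := by simpa using hR.posSemidef.dotProduct_mulVec_nonneg b
  have h4 := hX b
  have hle : ∀ j, b j ^ 2 ≤ ∑ i, b i ^ 2 := fun j =>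
    Finset.single_le_sum (f := fun i => b i ^ 2) (fun i _ => sq_nonneg _) (Finset.mem_univ j)
  set N := ∑ i, b i ^ 2
  have hN : 0 ≤ N := (sq_nonneg (b k)).trans (hle k)
  have h5 : b k ≤ √N := (le_abs_self _).trans (Real.abs_le_sqrt (hle k))
  have h6 : √N ≤ c⁻¹ := by
    rw [← one_div, le_div_iff₀ hc]
    by_contra! hlt
    have hs : 0 < √N := by
      rcases (Real.sqrt_nonneg N).eq_or_lt with h | h
      · rw [← h] at hlt; linarith
      · exact h
    have := Real.sq_sqrt hN
    nlinarith
  exact (Real.abs_le_sqrt (hle i)).trans h6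

lemma abs_mulVec_apply_le {m ι : Type*} [Fintype m] [Fintype ι]
    (A : Matrix m ι ℝ) {v : ι → ℝ} {c : ℝ} (hv : ∀ i, |v i| ≤ c) (j : m) :
    |(A *ᵥ v) j| ≤ (∑ i, |A j i|) * c := by
  rw [Matrix.mulVec, dotProduct, Finset.sum_mul]
  refine (Finset.abs_sum_le_sum_abs _ _).trans (Finset.sum_le_sum fun i _ => ?_)
  rw [abs_mul]
  exact mul_le_mul_of_nonneg_left (hv i) (abs_nonneg _)

lemma frobNorm_sq_sum_smul_diagonal {m ι : Type*} [Fintype m] [DecidableEq m] [Fintype ι]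
    (X : ι → m → ℝ) (v : ι → ℝ) :
    frobNorm (∑ n, (v n : ℂ) • Matrix.diagonal (fun j => (X n j : ℂ))) ^ 2 =
      ∑ j, (∑ n, X n j * v n) ^ 2 := by
  have h : ∑ n, (v n : ℂ) • Matrix.diagonal (fun j => (X n j : ℂ)) =
      Matrix.diagonal fun j => ((∑ n, X n j * v n : ℝ) : ℂ) := by
    ext i j
    rw [Matrix.sum_apply]
    by_cases hij : i = j
    · subst hij
      simp [mul_comm]
    · simp [hij]
  rw [h, frobNorm, Real.sq_sqrt (by positivity)]
  refine Finset.sum_congr rfl fun i _ => ?_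
  rw [Finset.sum_eq_single i (fun j _ hj => by simp [Matrix.diagonal_apply_ne' _ hj])
    (by simp), Matrix.diagonal_apply_eq, Complex.norm_real, Real.norm_eq_abs, sq_abs]

/-- A lower bound on the unit sphere extends to all real vectors by homogeneity. -/
lemma mul_sum_sq_le_of_lt_iInf_frobNorm {m ι : Type*} [Fintype m] [DecidableEq m] [Fintype ι]
    (X : ι → m → ℝ) {c t : ℝ} (ht : 0 ≤ t)
    (hX : c < ⨅ lam : Metric.sphere (0 : EuclideanSpace ℂ ι) 1,
      t * frobNorm (∑ n, ((lam : EuclideanSpace ℂ ι) n) •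
        Matrix.diagonal (fun j => (X n j : ℂ))) ^ 2) (v : ι → ℝ) :
    c * ∑ i, v i ^ 2 ≤ t * ∑ j, (∑ n, X n j * v n) ^ 2 := by
  set N := ∑ i, v i ^ 2 with hNdef
  have hN : 0 ≤ N := Finset.sum_nonneg fun i _ => sq_nonneg _
  rcases hN.eq_or_lt with h0 | hpos
  · rw [← h0, mul_zero]
    positivity
  have hs : 0 < √N := Real.sqrt_pos.2 hpos
  have hmem : (WithLp.toLp 2 fun i => ((v i / √N : ℝ) : ℂ) : EuclideanSpace ℂ ι) ∈
      Metric.sphere (0 : EuclideanSpace ℂ ι) 1 := by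
    rw [mem_sphere_zero_iff_norm, EuclideanSpace.norm_eq, Real.sqrt_eq_one]
    simp only [Complex.norm_real, Real.norm_eq_abs, sq_abs, div_pow, Real.sq_sqrt hN]
    rw [← Finset.sum_div, ← hNdef, div_self hpos.ne']
  have hbdd : BddBelow (Set.range fun lam : Metric.sphere (0 : EuclideanSpace ℂ ι) 1 =>
      t * frobNorm (∑ n, ((lam : EuclideanSpace ℂ ι) n) •
        Matrix.diagonal (fun j => (X n j : ℂ))) ^ 2) := by
    refine ⟨0, ?_⟩
    rintro _ ⟨lam, rfl⟩
    positivity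
  have h := hX.le.trans (ciInf_le hbdd ⟨_, hmem⟩)
  simp only [frobNorm_sq_sum_smul_diagonal] at h
  have h2 : ∑ j, (∑ n, X n j * (v n / √N)) ^ 2 = (∑ j, (∑ n, X n j * v n) ^ 2) / N := by
    simp only [← mul_div_assoc, ← Finset.sum_div, div_pow, Real.sq_sqrt hN]
  rw [h2, ← mul_div_assoc, le_div_iff₀ hpos] at h
  exact h

lemma inv_diagonal_apply_of_pos {m : Type*} [Fintype m] [DecidableEq m] {d : m → ℝ}
    (hd : ∀ i, 0 < d i) (i : m) : (Matrix.diagonal d)⁻¹ i i = (d i)⁻¹ := by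
  have h : (Matrix.diagonal d)⁻¹ = Matrix.diagonal fun i => (d i)⁻¹ := by
    refine Matrix.inv_eq_right_inv ?_
    rw [Matrix.diagonal_mul_diagonal, ← Matrix.diagonal_one]
    congr 1
    funext i
    exact mul_inv_cancel₀ (hd i).ne'
  rw [h, Matrix.diagonal_apply_eq]

lemma exists_pos_eventually_le_of_limsup_lt_top {f : ℕ → ℝ}
    (h : Filter.limsup (fun M => (f M : EReal)) Filter.atTop < ⊤) :
    ∃ b : ℝ, 0 < b ∧ ∀ᶠ M in Filter.atTop, f M ≤ b := by
  obtain ⟨b, hb, -⟩ := EReal.lt_iff_exists_real_btwn.1 h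
  refine ⟨max b 1, by positivity, ?_⟩
  filter_upwards [Filter.eventually_lt_of_limsup_lt hb] with M hM
  exact (EReal.coe_lt_coe_iff.1 hM).le.trans (le_max_left _ _)

/-- The noise and interference quadratic form is comparable to the squared Euclidean norm. -/
lemma noise_form_bounds {K : ℕ} (S : Finset (Fin K)) {p : Fin K → ℝ} (hp : ∀ n, 0 < p n)
    {ptr : ℝ} (hptr : 0 < ptr) {n : Type*} [Fintype n] [DecidableEq n]
    {C : Fin K → Matrix n n ℂ} (hC : ∀ i, (C i).PosSemidef) {b : ℝ} (hb : ∀ i, specNorm (C i) ≤ b)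
    (hb0 : 0 < b) (a : n → ℝ) :
    let F := (star (fun i => (a i : ℂ)) ⬝ᵥ
      ((((1 : ℂ) / ptr) • 1 + ∑ i ∈ S, C i)ᵀ ⊙ (1 + ∑ i, (p i : ℂ) • C i)) *ᵥ
        (fun i => (a i : ℂ))).re
    1 / ptr * ∑ i, a i ^ 2 ≤ F ∧
      F ≤ (1 / ptr + S.card * b) * ((1 + (∑ i, p i) * b) * ∑ i, a i ^ 2) := by
  intro F
  have hpC : ∀ i, ((p i : ℂ) • C i).PosSemidef := fun i =>
    (hC i).smul (by exact_mod_cast (hp i).le)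
  have hZ : (1 + ∑ i, (p i : ℂ) • C i : Matrix n n ℂ).PosSemidef :=
    Matrix.PosSemidef.one.add (Matrix.posSemidef_sum _ fun i _ => hpC i)
  have hZd : ∀ j, ((1 + ∑ i, (p i : ℂ) • C i : Matrix n n ℂ) j j).re =
      1 + ∑ i, p i * (C i j j).re := fun j => by
    simp [Matrix.sum_apply]
  have hCd : ∀ i j, 0 ≤ (C i j j).re := fun i j =>
    (Complex.nonneg_iff.1 (hC i).diag_nonneg).1
  have hCb : ∀ i j, (C i j j).re ≤ b := fun i j =>
    (Complex.re_le_norm _).trans ((norm_apply_le_specNorm _ _ _).trans (hb i))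
  constructor
  · have hQ : ((((1 : ℂ) / ptr) • 1 + ∑ i ∈ S, C i) - ((1 / ptr : ℝ) : ℂ) • 1).PosSemidef := by
      have : (((1 : ℂ) / ptr) • 1 + ∑ i ∈ S, C i) - ((1 / ptr : ℝ) : ℂ) • 1 = ∑ i ∈ S, C i := by
        push_cast
        abel
      rw [this]
      exact Matrix.posSemidef_sum _ fun i _ => hC i
    refine le_trans ?_ (le_re_dotProduct_hadamard hQ hZ a)
    gcongr with j
    rw [hZd]
    have : 0 ≤ ∑ i, p i * (C i j j).re :=
      Finset.sum_nonneg fun i _ => mul_nonneg (hp i).le (hCd i j)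
    nlinarith [sq_nonneg (a j)]
  · have hQ : (((1 / ptr + S.card * b : ℝ) : ℂ) • 1 -
        (((1 : ℂ) / ptr) • 1 + ∑ i ∈ S, C i)).PosSemidef := by
      have : ((1 / ptr + S.card * b : ℝ) : ℂ) • 1 - (((1 : ℂ) / ptr) • 1 + ∑ i ∈ S, C i) =
          ∑ i ∈ S, ((b : ℂ) • 1 - C i) := by
        rw [Finset.sum_sub_distrib, Finset.sum_const, ← Nat.cast_smul_eq_nsmul ℂ, smul_smul]
        push_cast
        rw [add_smul]
        abel
      rw [this]
      exact Matrix.posSemidef_sum _ fun i _ => (hC i).isHermitian.posSemidef_smul_one_sub (hb i)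
    refine (re_dotProduct_hadamard_le hQ hZ a).trans ?_
    rw [Finset.mul_sum _ _ (1 + (∑ i, p i) * b)]
    gcongr with j
    rw [hZd, Finset.sum_mul]
    gcongr with i
    · exact (hp i).le
    · exact hCb i j

/-- Theorem 4: with diagonal bilinear-equalizer transformations designed only
from the diagonals of the covariance matrices, the uplink SINR still grows linearly in the
number of antennas `M`. -/
theorem partial_covariance_information_linear_sinr_growth
    (K : ℕ) (hK : 1 ≤ K) (S : Finset (Fin K)) (hS : S.Nonempty)
    (k : Fin K) (hk : k ∈ S)
    (p : Fin K → ℝ) (hp : ∀ n, 0 < p n) (ptr : ℝ) (hptr : 0 < ptr)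
    (R : Matrix S S ℝ) (hR : R.PosDef)
    (C : (M : ℕ) → Fin K → Matrix (Fin M) (Fin M) ℂ)
    (hC : ∀ M n, (C M n).PosSemidef)
    (chat : (M : ℕ) → Fin K → Fin M → ℝ)
    (hchat : ∀ M n m, C M n m m = ((chat M n m : ℝ) : ℂ))
    (Ξhat : (M : ℕ) → Matrix (Fin M) S ℝ)
    (hΞhat : ∀ M, Ξhat M = Matrix.of fun m (n : S) => chat M n m)
    (D : (M : ℕ) → Fin M → ℝ) (hD : ∀ M m, 0 < D M m)
    (ahat : (M : ℕ) → Fin M → ℝ)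
    (hahat : ∀ M, ahat M =
      (Matrix.diagonal (D M) * Ξhat M *
        (R + (Ξhat M)ᵀ * Matrix.diagonal (D M) * Ξhat M)⁻¹) *ᵥ
          Pi.single (⟨k, hk⟩ : S) (1 : ℝ))
    (Z : (M : ℕ) → Matrix (Fin M) (Fin M) ℂ)
    (hZ : ∀ M, Z M = 1 + ∑ n, (p n : ℂ) • C M n)
    (Q : (M : ℕ) → Matrix (Fin M) (Fin M) ℂ)
    (hQ : ∀ M, Q M = ((1 : ℂ) / ptr) • 1 + ∑ n ∈ S, C M n)
    (γ : ℕ → ℝ)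
    (hγ : ∀ M, γ M =
      p k * (∑ m, chat M k m * ahat M m) ^ 2 /
        ((star (fun m => ((ahat M m : ℝ) : ℂ)) ⬝ᵥ
            ((Q M)ᵀ ⊙ Z M) *ᵥ (fun m => ((ahat M m : ℝ) : ℂ))).re +
          ∑ n ∈ S.erase k, p n * (∑ m, chat M n m * ahat M m) ^ 2))
    (hcond2 : 0 < Filter.liminf (fun M : ℕ =>
      ((⨅ lam : Metric.sphere (0 : EuclideanSpace ℂ S) 1,
          (1 / M : ℝ) * frobNorm (∑ n : S,
            ((lam : EuclideanSpace ℂ S) n) •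
              Matrix.diagonal (fun m => ((chat M n m : ℝ) : ℂ))) ^ 2
        : ℝ) : EReal)) Filter.atTop)
    (hcond3 : ∀ n : Fin K,
      Filter.limsup (fun M : ℕ => ((specNorm (C M n) : ℝ) : EReal)) Filter.atTop < ⊤)
    (hcondD : Filter.limsup
        (fun M : ℕ => ((specNorm (Matrix.diagonal (D M)) : ℝ) : EReal)) Filter.atTop < ⊤ ∧
      Filter.limsup
        (fun M : ℕ => ((specNorm (Matrix.diagonal (D M))⁻¹ : ℝ) : EReal)) Filter.atTop < ⊤) :
    0 < Filter.liminf (fun M : ℕ => ((γ M / M : ℝ) : EReal)) Filter.atTop := by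
  obtain ⟨c, hcpos, hcM⟩ := EReal.lt_iff_exists_real_btwn.1 hcond2
  have hc : 0 < c := EReal.coe_pos.1 hcpos
  choose b' hb' hbM' using fun n => exists_pos_eventually_le_of_limsup_lt_top (hcond3 n)
  obtain ⟨d₁, hd₁, hdM₁⟩ := exists_pos_eventually_le_of_limsup_lt_top hcondD.1
  obtain ⟨d₂, hd₂, hdM₂⟩ := exists_pos_eventually_le_of_limsup_lt_top hcondD.2
  set b := ∑ n, b' n with hb
  have hb0 : 0 < b := Finset.sum_pos (fun n _ => hb' n) ⟨k, Finset.mem_univ k⟩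
  have hbM : ∀ᶠ M in atTop, ∀ n, specNorm (C M n) ≤ b := by
    filter_upwards [Filter.eventually_all.2 hbM'] with M hM n
    exact (hM n).trans (Finset.single_le_sum (fun i _ => (hb' i).le) (Finset.mem_univ n))
  set r := ∑ i, ∑ j, |R i j| with hr
  have hr0 : 0 ≤ r := by positivity
  set e := c / d₂ with he
  have he0 : 0 < e := by positivity
  set A := (1 / ptr + S.card * b) * (1 + (∑ n, p n) * b) * (d₁ * (S.card * b) / e) ^ 2 with hA
  have hp0 : 0 < ∑ n, p n := Finset.sum_pos (fun n _ => hp n) ⟨k, Finset.mem_univ k⟩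
  have hA0 : 0 ≤ A := by positivity
  set I := (∑ n, p n) * (r / e) ^ 2 with hI
  have hI0 : 0 ≤ I := by positivity
  have hpk := hp k
  have hgoal : ∀ᶠ M : ℕ in atTop, p k / 4 / (A + I + 1) ≤ γ M / M := by
    filter_upwards [Filter.eventually_lt_of_lt_liminf hcM, hbM, hdM₁, hdM₂,
      eventually_ge_atTop 1, (tendsto_natCast_atTop_atTop (R := ℝ)).eventually_ge_atTop
        (2 * (r / e))] with M hfrob hCM hDM hDinv hM1 hM2
    have hM0 : (0 : ℝ) < M := by exact_mod_cast hM1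
    have hM1' : (1 : ℝ) ≤ M := by exact_mod_cast hM1
    have hDle : ∀ m, D M m ≤ d₁ := fun m => by
      have := (norm_apply_le_specNorm (Matrix.diagonal (D M)) m m).trans hDM
      rw [Matrix.diagonal_apply_eq] at this
      exact (le_abs_self _).trans this
    have hDge : ∀ m, d₂⁻¹ ≤ D M m := fun m => by
      have := (norm_apply_le_specNorm (Matrix.diagonal (D M))⁻¹ m m).trans hDinv
      rw [inv_diagonal_apply_of_pos (hD M)] at this
      exact inv_le_of_inv_le₀ (hD M m) ((le_abs_self _).trans this)
    have hchatb : ∀ n m, |chat M n m| ≤ b := fun n m => by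
      have := (norm_apply_le_specNorm (C M n) m m).trans (hCM n)
      rwa [hchat, Complex.norm_real] at this
    have hX : ∀ v : S → ℝ, (e * M) * ∑ i, v i ^ 2 ≤
        ∑ i, D M i * (Ξhat M *ᵥ v) i ^ 2 := fun v => by
      have h := mul_sum_sq_le_of_lt_iInf_frobNorm (fun (n : S) m => chat M n m)
        (by positivity) (EReal.coe_lt_coe_iff.1 hfrob) v
      have h' : ∀ j, (Ξhat M *ᵥ v) j = ∑ n : S, chat M n j * v n := fun j => by
        rw [hΞhat]; rfl
      simp only [h']
      calc (e * M) * ∑ i, v i ^ 2 = d₂⁻¹ * M * (c * ∑ i, v i ^ 2) := by rw [he]; ring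
        _ ≤ d₂⁻¹ * M * (1 / M * ∑ j, (∑ n : S, chat M n j * v n) ^ 2) := by gcongr
        _ = d₂⁻¹ * ∑ j, (∑ n : S, chat M n j * v n) ^ 2 := by field_simp
        _ ≤ _ := by
          rw [Finset.mul_sum]
          gcongr with j
          exact hDge j
    set x := (R + (Ξhat M)ᵀ * Matrix.diagonal (D M) * Ξhat M)⁻¹ *ᵥ
      Pi.single (⟨k, hk⟩ : S) (1 : ℝ) with hx
    have hxb : ∀ i, |x i| ≤ (e * M)⁻¹ :=
      abs_regularized_gram_inv_apply_le hR (Ξhat M) (hD M) (by positivity) hX _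
    have ha : ahat M = fun m => D M m * (Ξhat M *ᵥ x) m := by
      rw [hahat, hx, ← Matrix.mulVec_mulVec, ← Matrix.mulVec_mulVec]
      funext m
      rw [Matrix.mulVec_diagonal]
    have hdot : ∀ n : S, ∑ m, chat M n m * ahat M m =
        (Pi.single (⟨k, hk⟩ : S) (1 : ℝ) : S → ℝ) n - (R *ᵥ x) n := fun n => by
      have := congrFun (regularized_gram_mulVec_inv hR (Ξhat M) (hD M)
        (Pi.single (⟨k, hk⟩ : S) (1 : ℝ))) n
      rw [Pi.sub_apply, ← hx] at this
      rw [← this, ← Matrix.mulVec_mulVec, ← Matrix.mulVec_mulVec, Matrix.mulVec, dotProduct]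
      refine Finset.sum_congr rfl fun m _ => ?_
      rw [Matrix.mulVec_diagonal, ha, Matrix.transpose_apply, hΞhat, Matrix.of_apply]
    have hRx : ∀ n, |(R *ᵥ x) n| ≤ r / e / M := fun n => by
      refine (abs_mulVec_apply_le R hxb n).trans ?_
      rw [div_div, div_eq_mul_inv]
      gcongr
      exact Finset.single_le_sum (f := fun i => ∑ j, |R i j|)
        (fun i _ => Finset.sum_nonneg fun j _ => abs_nonneg _) (Finset.mem_univ n)
    have hnum : 1 / 4 ≤ (∑ m, chat M k m * ahat M m) ^ 2 := by
      have h := hdot ⟨k, hk⟩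
      rw [Pi.single_eq_same] at h
      have h' := (abs_le.1 (hRx ⟨k, hk⟩)).2
      have h'' : r / e / M ≤ 1 / 2 := by
        rw [div_le_iff₀ hM0]; linarith
      have : 1 / 2 ≤ ∑ m, chat M k m * ahat M m := by rw [h]; linarith
      nlinarith
    have hint : ∑ n ∈ S.erase k, p n * (∑ m, chat M n m * ahat M m) ^ 2 ≤ I / M := by
      calc ∑ n ∈ S.erase k, p n * (∑ m, chat M n m * ahat M m) ^ 2
          ≤ ∑ n ∈ S.erase k, p n * (r / e / M) ^ 2 := by
            refine Finset.sum_le_sum fun n hn => ?_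
            obtain ⟨hnk, hnS⟩ := Finset.mem_erase.1 hn
            refine mul_le_mul_of_nonneg_left ?_ (hp n).le
            have h := hdot ⟨n, hnS⟩
            rw [Pi.single_eq_of_ne (by simpa using hnk), zero_sub] at h
            rw [h, neg_sq, ← sq_abs]
            gcongr
            exact hRx _
        _ ≤ ∑ n, p n * (r / e / M) ^ 2 :=
            Finset.sum_le_sum_of_subset_of_nonneg (Finset.subset_univ _)
              fun n _ _ => mul_nonneg (hp n).le (sq_nonneg _)
        _ = I / M / M := by rw [← Finset.sum_mul, hI]; field_simp
        _ ≤ I / M := div_le_self (by positivity) hM1'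
    have hab : ∑ m, ahat M m ^ 2 ≤ (d₁ * (S.card * b) / e) ^ 2 / M := by
      have hm : ∀ m, ahat M m ^ 2 ≤ (d₁ * (S.card * b * (e * M)⁻¹)) ^ 2 := fun m => by
        have hDm := hD M m
        rw [ha, ← sq_abs, abs_mul, abs_of_pos hDm]
        have hrow : ∑ i, |Ξhat M m i| ≤ S.card * b := by
          have := Finset.sum_le_card_nsmul Finset.univ (fun i : S => |Ξhat M m i|) b
            fun i _ => by rw [hΞhat]; exact hchatb _ _
          simpa using this
        gcongr
        · exact hDle m
        · exact (abs_mulVec_apply_le (Ξhat M) hxb m).trans (by gcongr)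
      refine (Finset.sum_le_sum fun m _ => hm m).trans_eq ?_
      rw [Finset.sum_const, Finset.card_univ, Fintype.card_fin, nsmul_eq_mul]
      field_simp
    obtain ⟨hF1, hF2⟩ := noise_form_bounds S hp hptr (hC M) hCM hb0 (ahat M)
    rw [← hZ, ← hQ] at hF1 hF2
    set F := (star (fun m => ((ahat M m : ℝ) : ℂ)) ⬝ᵥ
      ((Q M)ᵀ ⊙ Z M) *ᵥ (fun m => ((ahat M m : ℝ) : ℂ))).re with hF
    have hF2' : F ≤ A / M := by
      refine hF2.trans ?_
      calc _ ≤ (1 / ptr + S.card * b) * ((1 + (∑ i, p i) * b) *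
            ((d₁ * (S.card * b) / e) ^ 2 / M)) := by gcongr
        _ = A / M := by rw [hA]; ring
    have hapos : 0 < ∑ m, ahat M m ^ 2 := by
      by_contra! hle
      have hz : ∀ m, ahat M m = 0 := fun m => by
        have h := Finset.single_le_sum (f := fun m => ahat M m ^ 2) (fun i _ => sq_nonneg _)
          (Finset.mem_univ m)
        exact pow_eq_zero_iff two_ne_zero |>.1 (le_antisymm (h.trans hle) (sq_nonneg _))
      simp only [hz, mul_zero, Finset.sum_const_zero] at hnum
      norm_num at hnum
    have hFpos : 0 < F := lt_of_lt_of_le (by positivity) hF1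
    have hIpos : 0 ≤ ∑ n ∈ S.erase k, p n * (∑ m, chat M n m * ahat M m) ^ 2 :=
      Finset.sum_nonneg fun n _ => mul_nonneg (hp n).le (sq_nonneg _)
    rw [hγ, ← hF, div_div (p k * _)]
    refine div_le_div₀ (by positivity) (by linarith [mul_le_mul_of_nonneg_left hnum hpk.le])
      (mul_pos (by linarith) hM0) ?_
    have : F + ∑ n ∈ S.erase k, p n * (∑ m, chat M n m * ahat M m) ^ 2 ≤ (A + I) / M := by
      rw [add_div]; exact add_le_add hF2' hint
    rw [le_div_iff₀ hM0] at this
    linarith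
  refine lt_of_lt_of_le (b := ((p k / 4 / (A + I + 1) : ℝ) : EReal))
    (EReal.coe_pos.2 (by positivity)) (Filter.le_liminf_of_le (by isBoundedDefault) ?_)
  filter_upwards [hgoal] with M hM
  exact_mod_cast hM
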